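/- arXiv:2605.16838 — 3 statements merged into one kernel-verified Lean document; each statement's English description precedes it below -/
import Mathlib

section
/- Let p ≥ 1 and let G be a finite simple graph with independence number α(G) = r ≥ 1. Then G belongs to W_p if and only if G is well-covered and |F_G(S)| ≥ p for every independent set S of G with |S| = r − 1. -/
open Finset
open scoped Classical

/-- `S` is an independent set of the graph `G`. -/
def IsIndep {V : Type*} (G : SimpleGraph V) (S : Finset V) : Prop :=
  ∀ ⦃x⦄, x ∈ S → ∀ ⦃y⦄, y ∈ S → x ≠ y → ¬ G.Adj x y

/-- The independence number `α(G)` of a finite graph `G`. -/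
noncomputable def alpha {V : Type*} [Fintype V] (G : SimpleGraph V) : ℕ :=
  Finset.univ.sup fun S : Finset V => if IsIndep G S then S.card else 0

/-- `S` is a maximum independent set of `G`. -/
def IsMaxIndep {V : Type*} [Fintype V] (G : SimpleGraph V) (S : Finset V) : Prop :=
  IsIndep G S ∧ S.card = alpha G

/-- `S` is a maximal (inclusion-wise) independent set of `G`. -/
def IsMaximalIndep {V : Type*} [DecidableEq V] (G : SimpleGraph V) (S : Finset V) : Prop :=
  IsIndep G S ∧ ∀ x, x ∉ S → ¬ IsIndep G (insert x S)

/-- `G` is well-covered: every maximal independent set has cardinality `α(G)`. -/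
def WellCovered {V : Type*} [Fintype V] [DecidableEq V] (G : SimpleGraph V) : Prop :=
  ∀ S : Finset V, IsMaximalIndep G S → S.card = alpha G

/-- `G ∈ W_p`: `|V(G)| ≥ p` and every `p` pairwise disjoint independent sets extend to
`p` pairwise disjoint maximum independent sets. -/
def MemW {V : Type*} [Fintype V] (G : SimpleGraph V) (p : ℕ) : Prop :=
  p ≤ Fintype.card V ∧
    ∀ A : Fin p → Finset V, (∀ i, IsIndep G (A i)) →
      (∀ i j, i ≠ j → Disjoint (A i) (A j)) →
      ∃ M : Fin p → Finset V, (∀ i, IsMaxIndep G (M i)) ∧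
        (∀ i j, i ≠ j → Disjoint (M i) (M j)) ∧ ∀ i, A i ⊆ M i

/-- The `W`-index of `G`: the largest `p` with `G ∈ W_p`. -/
noncomputable def wIndex {V : Type*} [Fintype V] (G : SimpleGraph V) : ℕ :=
  sSup {p : ℕ | MemW G p}

/-- The fiber `F_G(S)`: the vertices `x ∉ S` with `S ∪ {x}` a maximum independent set. -/
noncomputable def fiber {V : Type*} [Fintype V] [DecidableEq V]
    (G : SimpleGraph V) (S : Finset V) : Finset V :=
  Finset.univ.filter fun x => x ∉ S ∧ IsMaxIndep G (insert x S)

/-- `G` is `α`-critical: deleting any edge increases the independence number. -/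
def AlphaCritical {V : Type*} [Fintype V] (G : SimpleGraph V) : Prop :=
  ∀ x y, G.Adj x y → alpha G < alpha (G.deleteEdges {s(x, y)})

/-- `H` is `K_t`-saturated: `H` is `K_t`-free but adding any missing edge creates a `K_t`. -/
def KSaturated {V : Type*} [Fintype V] (H : SimpleGraph V) (t : ℕ) : Prop :=
  (∀ Q : Finset V, ¬ H.IsNClique t Q) ∧
    ∀ x y : V, x ≠ y → ¬ H.Adj x y →
      ∃ Q : Finset V, (H ⊔ SimpleGraph.fromEdgeSet {s(x, y)}).IsNClique t Q

/-- `Q` is an inclusion-maximal clique of `H`. -/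
def IsMaximalClique {V : Type*} [DecidableEq V] (H : SimpleGraph V) (Q : Finset V) : Prop :=
  H.IsClique (Q : Set V) ∧ ∀ x, x ∉ Q → ¬ H.IsClique ((insert x Q : Finset V) : Set V)

/-- The `(r-1)`-clique-codegree of `Q` in `H`: the number of vertices extending `Q`
to an `r`-clique of `H`. -/
noncomputable def codeg {V : Type*} [Fintype V] [DecidableEq V]
    (H : SimpleGraph V) (r : ℕ) (Q : Finset V) : ℕ :=
  (Finset.univ.filter fun x => x ∉ Q ∧ H.IsNClique r (insert x Q)).card

/-- The minimum `(r-1)`-clique-codegree `δ^cl_{r-1}(H)`. -/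
noncomputable def minCliqueCodeg {V : Type*} [Fintype V] [DecidableEq V]
    (H : SimpleGraph V) (r : ℕ) : ℕ :=
  sInf {m : ℕ | ∃ Q : Finset V, H.IsNClique (r - 1) Q ∧ codeg H r Q = m}

/-- The vertex set of the localization `G_S = G - N_G[S]`. -/
noncomputable def localVerts {V : Type*} [Fintype V] (G : SimpleGraph V) (S : Finset V) :
    Finset V :=
  Finset.univ.filter fun v => v ∉ S ∧ ∀ s ∈ S, ¬ G.Adj s v

/-- The localization `G_S = G - N_G[S]`, as an induced subgraph. -/
noncomputable def localize {V : Type*} [Fintype V] (G : SimpleGraph V) (S : Finset V) :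
    SimpleGraph {v : V // v ∈ localVerts G S} :=
  SimpleGraph.comap (fun v => (v : V)) G

/-- The vertex set of the edge-localization `G_{ab} = G - (N_G(a) ∪ N_G(b))`. -/
noncomputable def edgeVerts {V : Type*} [Fintype V] (G : SimpleGraph V) (a b : V) : Finset V :=
  Finset.univ.filter fun v => ¬ G.Adj a v ∧ ¬ G.Adj b v

/-- The edge-localization `G_{ab} = G - (N_G(a) ∪ N_G(b))`, as an induced subgraph. -/
noncomputable def edgeLocalize {V : Type*} [Fintype V] (G : SimpleGraph V) (a b : V) :
    SimpleGraph {v : V // v ∈ edgeVerts G a b} :=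
  SimpleGraph.comap (fun v => (v : V)) G

theorem IsIndep.mono {V : Type*} {G : SimpleGraph V} {S T : Finset V} (hT : IsIndep G T)
    (h : S ⊆ T) : IsIndep G S :=
  fun _ hx _ hy => hT (h hx) (h hy)

theorem isIndep_empty {V : Type*} (G : SimpleGraph V) : IsIndep G ∅ :=
  fun _ hx => absurd hx (Finset.notMem_empty _)

theorem IsIndep.card_le_alpha {V : Type*} [Fintype V] {G : SimpleGraph V} {S : Finset V}
    (hS : IsIndep G S) : S.card ≤ alpha G := by
  have h := Finset.le_sup (f := fun S : Finset V => if IsIndep G S then S.card else 0)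
    (Finset.mem_univ S)
  rwa [if_pos hS] at h

/-- In a well-covered graph every independent set lies in a maximum independent set. -/
theorem WellCovered.exists_isMaxIndep_superset {V : Type*} [Fintype V] [DecidableEq V]
    {G : SimpleGraph V} (hG : WellCovered G) {S : Finset V} (hS : IsIndep G S) :
    ∃ M, S ⊆ M ∧ IsMaxIndep G M := by
  obtain ⟨M, hSM, hM⟩ := (Set.toFinite {T | IsIndep G T}).exists_le_maximal hS
  refine ⟨M, hSM, hM.prop, hG M ⟨hM.prop, fun x hx hins => hx ?_⟩⟩
  exact hM.le_of_ge hins (Finset.subset_insert x M) (Finset.mem_insert_self x M)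

/-- In a well-covered graph every non-maximum independent set extends to an independent set
with `α(G) - 1` elements. -/
theorem WellCovered.exists_superset_card_pred {V : Type*} [Fintype V] [DecidableEq V]
    {G : SimpleGraph V} (hG : WellCovered G) {S : Finset V} (hS : IsIndep G S)
    (hlt : S.card < alpha G) :
    ∃ T, S ⊆ T ∧ IsIndep G T ∧ T.card = alpha G - 1 := by
  obtain ⟨M, hSM, hM⟩ := hG.exists_isMaxIndep_superset hS
  have hcard := hM.2
  obtain ⟨T, hST, hTM, hT⟩ :=
    Finset.exists_subsuperset_card_eq hSM (show S.card ≤ alpha G - 1 by omega) (by omega)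
  exact ⟨T, hST, hM.1.mono hTM, hT⟩

theorem mem_fiber {V : Type*} [Fintype V] [DecidableEq V] {G : SimpleGraph V} {S : Finset V}
    {x : V} : x ∈ fiber G S ↔ x ∉ S ∧ IsMaxIndep G (insert x S) := by
  simp [fiber]

/-- Fibers are cliques. -/
theorem adj_of_mem_fiber {V : Type*} [Fintype V] [DecidableEq V] {G : SimpleGraph V}
    {S : Finset V} {x y : V} (hx : x ∈ fiber G S) (hy : y ∈ fiber G S) (hxy : x ≠ y) :
    G.Adj x y := by
  rw [mem_fiber] at hx hy
  by_contra hadj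
  have hind : IsIndep G (insert x (insert y S)) := by
    intro a ha b hb hab
    have hx' := @hx.2.1 a
    have hy' := @hy.2.1 a
    have hadj' : ¬ G.Adj y x := fun h => hadj h.symm
    simp only [Finset.mem_insert] at ha hb hx' hy'
    grind
  have hle := hind.card_le_alpha
  have hcard := hy.2.2
  rw [Finset.card_insert_of_notMem (by simp [hxy, hx.1]), hcard] at hle
  omega

theorem card_fiber_inter_le_one {V : Type*} [Fintype V] [DecidableEq V] {G : SimpleGraph V}
    {S A : Finset V} (hA : IsIndep G A) : (fiber G S ∩ A).card ≤ 1 := by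
  rw [Finset.card_le_one]
  intro x hx y hy
  rw [Finset.mem_inter] at hx hy
  by_contra hxy
  exact hA hx.2 hy.2 hxy (adj_of_mem_fiber hx.1 hy.1 hxy)

/-- If all fibers have at least `p` elements, a non-maximum member of a family of `p`
independent sets can be enlarged by a vertex outside all of them. -/
theorem exists_isIndep_insert {V : Type*} [Fintype V] [DecidableEq V] {G : SimpleGraph V}
    {p : ℕ} (hG : WellCovered G)
    (hF : ∀ S : Finset V, IsIndep G S → S.card = alpha G - 1 → p ≤ (fiber G S).card)
    {A : Fin p → Finset V} (hA : ∀ i, IsIndep G (A i)) {i : Fin p}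
    (hi : (A i).card < alpha G) :
    ∃ x, (∀ j, x ∉ A j) ∧ IsIndep G (insert x (A i)) := by
  obtain ⟨T, hAT, hT, hTcard⟩ := hG.exists_superset_card_pred (hA i) hi
  have hsmall : ((Finset.univ.erase i).biUnion fun j => fiber G T ∩ A j).card
      < (fiber G T).card := by
    have hle := Finset.card_biUnion_le_card_mul (Finset.univ.erase i)
      (fun j => fiber G T ∩ A j) 1 fun j _ => card_fiber_inter_le_one (hA j)
    rw [Finset.card_erase_of_mem (Finset.mem_univ i), Finset.card_univ, Fintype.card_fin] at hle
    have hfib := hF T hT hTcard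
    have hpos := i.pos
    omega
  obtain ⟨x, hx, hxU⟩ := Finset.exists_mem_notMem_of_card_lt_card hsmall
  have hx' := mem_fiber.1 hx
  refine ⟨x, fun j hj => ?_, hx'.2.1.mono (Finset.insert_subset_insert x hAT)⟩
  rcases eq_or_ne j i with rfl | hji
  · exact hx'.1 (hAT hj)
  · exact hxU (Finset.mem_biUnion.2
      ⟨j, Finset.mem_erase.2 ⟨hji, Finset.mem_univ j⟩, Finset.mem_inter.2 ⟨hx, hj⟩⟩)

/-- A well-covered graph of positive independence number whose fibers all have at least `p`
elements belongs to `W_p`. -/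
theorem WellCovered.memW {V : Type*} [Fintype V] [DecidableEq V] {G : SimpleGraph V}
    {p : ℕ} (hG : WellCovered G) (hpos : 0 < alpha G)
    (hF : ∀ S : Finset V, IsIndep G S → S.card = alpha G - 1 → p ≤ (fiber G S).card) :
    MemW G p := by
  refine ⟨?_, fun A hA hdisj => ?_⟩
  · obtain ⟨T, -, hT, hTcard⟩ := hG.exists_superset_card_pred (isIndep_empty G) (by simpa)
    exact (hF T hT hTcard).trans (Finset.card_le_univ _)
  obtain ⟨M, hAM, hM⟩ := (Set.toFinite {B : Fin p → Finset V | (∀ i, IsIndep G (B i)) ∧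
    ∀ i j, i ≠ j → Disjoint (B i) (B j)}).exists_le_maximal ⟨hA, hdisj⟩
  obtain ⟨hMind, hMdisj⟩ := hM.prop
  refine ⟨M, fun i => ⟨hMind i, ?_⟩, hMdisj, hAM⟩
  by_contra hne
  obtain ⟨x, hxM, hx⟩ :=
    exists_isIndep_insert hG hF hMind (lt_of_le_of_ne (hMind i).card_le_alpha hne)
  have hmem : Function.update M i (insert x (M i)) ∈ {B : Fin p → Finset V |
      (∀ i, IsIndep G (B i)) ∧ ∀ i j, i ≠ j → Disjoint (B i) (B j)} := by
    refine ⟨fun j => ?_, fun j k hjk => ?_⟩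
    · rcases eq_or_ne j i with rfl | hji
      · simpa using hx
      · simpa [hji] using hMind j
    · rcases eq_or_ne j i with rfl | hji
      · simpa [hjk.symm, hxM k] using hMdisj j k hjk
      · rcases eq_or_ne k i with rfl | hki
        · simpa [hji, hxM j] using hMdisj j k hjk
        · simpa [hji, hki] using hMdisj j k hjk
  have hle : M ≤ Function.update M i (insert x (M i)) :=
    le_update_iff.2 ⟨Finset.subset_insert x (M i), fun _ _ => le_rfl⟩
  have hxi := hM.le_of_ge hmem hle i
  rw [Function.update_self] at hxi
  exact hxM i (hxi (Finset.mem_insert_self x (M i)))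

theorem MemW.wellCovered {V : Type*} [Fintype V] [DecidableEq V] {G : SimpleGraph V}
    {p : ℕ} (hG : MemW G p) (hp : 0 < p) : WellCovered G := by
  intro S hS
  obtain ⟨M, hM, -, hSM⟩ := hG.2 (fun i => if i = ⟨0, hp⟩ then S else ∅)
    (fun i => by split_ifs; exacts [hS.1, isIndep_empty G])
    (fun i j hij => by split_ifs <;> simp_all)
  have hsub : S ⊆ M ⟨0, hp⟩ := by simpa using hSM ⟨0, hp⟩
  have heq : S = M ⟨0, hp⟩ := by
    refine hsub.antisymm fun x hx => ?_
    by_contra hxS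
    exact hS.2 x hxS ((hM _).1.mono (Finset.insert_subset hx hsub))
  rw [heq]
  exact (hM _).2

theorem MemW.le_card_fiber {V : Type*} [Fintype V] [DecidableEq V] {G : SimpleGraph V}
    {p : ℕ} (hG : MemW G p) {S : Finset V} (hS : IsIndep G S) (hcard : S.card + 1 = alpha G) :
    p ≤ (fiber G S).card := by
  by_contra! hlt
  have hp : 0 < p := by omega
  obtain ⟨g⟩ : Nonempty (fiber G S ↪ {i : Fin p // i ≠ ⟨0, hp⟩}) := by
    refine Function.Embedding.nonempty_of_card_le ?_
    simp only [Fintype.card_coe, ne_eq, Fintype.card_subtype_compl, Fintype.card_fin,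
      Fintype.card_unique]
    omega
  let A : Fin p → Finset V := fun i =>
    if i = ⟨0, hp⟩ then S
    else Finset.univ.filter fun x => ∃ h : x ∈ fiber G S, (g ⟨x, h⟩ : Fin p) = i
  have hA0 : A ⟨0, hp⟩ = S := if_pos rfl
  have hA : ∀ {i x}, i ≠ ⟨0, hp⟩ →
      (x ∈ A i ↔ ∃ h : x ∈ fiber G S, (g ⟨x, h⟩ : Fin p) = i) := by
    intro i x hi
    simp [A, hi]
  obtain ⟨M, hM, hdisj, hAM⟩ := hG.2 A
    (by
      intro i
      rcases eq_or_ne i ⟨0, hp⟩ with rfl | hi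
      · rwa [hA0]
      · intro x hx y hy hxy
        obtain ⟨hxF, hgx⟩ := (hA hi).1 hx
        obtain ⟨hyF, hgy⟩ := (hA hi).1 hy
        have := g.injective (Subtype.ext (hgx.trans hgy.symm))
        exact absurd (congrArg Subtype.val this) hxy)
    (by
      intro i j hij
      rw [Finset.disjoint_left]
      intro x hxi hxj
      rcases eq_or_ne i ⟨0, hp⟩ with rfl | hi
      · obtain ⟨hxF, -⟩ := (hA hij.symm).1 hxj
        exact (mem_fiber.1 hxF).1 (hA0 ▸ hxi)
      · obtain ⟨hxF, hgx⟩ := (hA hi).1 hxi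
        rcases eq_or_ne j ⟨0, hp⟩ with rfl | hj
        · exact (mem_fiber.1 hxF).1 (hA0 ▸ hxj)
        · obtain ⟨_, hgx'⟩ := (hA hj).1 hxj
          exact hij (hgx.symm.trans hgx'))
  have hSM : S ⊆ M ⟨0, hp⟩ := hA0 ▸ hAM ⟨0, hp⟩
  have hM0 := (hM ⟨0, hp⟩).2
  obtain ⟨y, hyM, hyS⟩ :=
    Finset.exists_mem_notMem_of_card_lt_card (show S.card < (M ⟨0, hp⟩).card by omega)
  have hyF : y ∈ fiber G S := mem_fiber.2 ⟨hyS,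
    (hM ⟨0, hp⟩).1.mono (Finset.insert_subset hyM hSM),
    by rw [Finset.card_insert_of_notMem hyS, hcard]⟩
  have hne := (g ⟨y, hyF⟩).2
  exact Finset.disjoint_left.1 (hdisj _ _ hne) (hAM _ ((hA hne).2 ⟨hyF, rfl⟩)) hyM

/-- Ridge-thickness characterization of `W_p`. -/
theorem wp_iff_wellCovered_fibers {V : Type*} [Fintype V] [DecidableEq V]
    (G : SimpleGraph V) (p r : ℕ) (hp : 1 ≤ p) (hr : 1 ≤ r) (halpha : alpha G = r) :
    MemW G p ↔
      (WellCovered G ∧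
        ∀ S : Finset V, IsIndep G S → S.card = r - 1 → p ≤ (fiber G S).card) := by
  subst halpha
  refine ⟨fun h => ⟨h.wellCovered hp, fun S hS hcard => h.le_card_fiber hS (by omega)⟩,
    fun h => h.1.memW hr h.2⟩
end

section
/- Let p ≥ 1, let G be a finite simple graph with independence number α(G) = 2, and let H be the complement of G. Then G is α-critical and belongs to W_p if and only if H is maximal triangle-free and the minimum degree of H is at least p. In this case, the W-index of G satisfies w(G) = δ(H). -/
open Finset
open scoped Classical

theorem isIndep_iff_isClique_compl {V : Type*} (G : SimpleGraph V) (S : Finset V) :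
    IsIndep G S ↔ Gᶜ.IsClique (S : Set V) := by
  constructor
  · intro h x hx y hy hxy
    exact (SimpleGraph.compl_adj G x y).2 ⟨hxy, h hx hy hxy⟩
  · intro h x hx y hy hxy
    exact ((SimpleGraph.compl_adj G x y).1 (h hx hy hxy)).2

theorem exists_isMaxIndep {V : Type*} [Fintype V] (G : SimpleGraph V) :
    ∃ S, IsMaxIndep G S := by
  obtain ⟨S, -, hS⟩ := Finset.exists_mem_eq_sup (Finset.univ : Finset (Finset V))
    Finset.univ_nonempty (fun S : Finset V => if IsIndep G S then S.card else 0)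
  change alpha G = _ at hS
  by_cases h : IsIndep G S
  · exact ⟨S, h, by rw [hS, if_pos h]⟩
  · have h0 : IsIndep G (∅ : Finset V) := fun x hx => absurd hx (Finset.notMem_empty x)
    exact ⟨∅, h0, by rw [hS, if_neg h, Finset.card_empty]⟩

theorem nonempty_of_alpha_pos {V : Type*} [Fintype V] {G : SimpleGraph V} (h : 0 < alpha G) :
    Nonempty V := by
  obtain ⟨S, -, hS⟩ := exists_isMaxIndep G
  obtain ⟨x, -⟩ := Finset.card_pos.1 (hS ▸ h)
  exact ⟨x⟩

theorem le_alpha_iff_exists_isNClique_compl {V : Type*} [Fintype V] (G : SimpleGraph V) (k : ℕ) :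
    k ≤ alpha G ↔ ∃ Q : Finset V, Gᶜ.IsNClique k Q := by
  constructor
  · intro h
    obtain ⟨S, hS, hc⟩ := exists_isMaxIndep G
    obtain ⟨Q, hQS, hQ⟩ := Finset.exists_subset_card_eq (hc ▸ h)
    exact ⟨Q, (isIndep_iff_isClique_compl G Q).1 (hS.mono hQS), hQ⟩
  · rintro ⟨Q, hQ, rfl⟩
    exact ((isIndep_iff_isClique_compl G Q).2 hQ).card_le_alpha

theorem compl_deleteEdges_pair {V : Type*} (G : SimpleGraph V) (x y : V) :
    (G.deleteEdges {s(x, y)})ᶜ = Gᶜ ⊔ SimpleGraph.fromEdgeSet {s(x, y)} := by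
  ext a b
  simp only [SimpleGraph.compl_adj, SimpleGraph.deleteEdges_adj, SimpleGraph.sup_adj,
    SimpleGraph.fromEdgeSet_adj]
  tauto

theorem alphaCritical_iff_kSaturated_compl {V : Type*} [Fintype V] (G : SimpleGraph V) :
    AlphaCritical G ↔ KSaturated Gᶜ (alpha G + 1) := by
  have hfree : ∀ Q : Finset V, ¬ Gᶜ.IsNClique (alpha G + 1) Q := fun Q hQ =>
    absurd ((le_alpha_iff_exists_isNClique_compl G _).2 ⟨Q, hQ⟩) (by omega)
  have hcrit : ∀ x y, alpha G < alpha (G.deleteEdges {s(x, y)}) ↔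
      ∃ Q : Finset V,
        (Gᶜ ⊔ SimpleGraph.fromEdgeSet {s(x, y)}).IsNClique (alpha G + 1) Q := fun x y => by
    rw [← compl_deleteEdges_pair, ← le_alpha_iff_exists_isNClique_compl, Nat.succ_le_iff]
  simp only [AlphaCritical, KSaturated, hcrit]
  constructor
  · refine fun h => ⟨hfree, fun x y hxy hadj => h x y ?_⟩
    by_contra hG
    exact hadj ((SimpleGraph.compl_adj G x y).2 ⟨hxy, hG⟩)
  · exact fun h x y hadj => h.2 x y hadj.ne
      fun hc => ((SimpleGraph.compl_adj G x y).1 hc).2 hadj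

/-- When `α(G) = 2`, a closed neighbourhood in the complement having at most `p` vertices,
split into singletons, obstructs `G ∈ W_p`. -/
theorem MemW.le_minDegree_compl {V : Type*} [Fintype V] [DecidableEq V] {G : SimpleGraph V}
    {p : ℕ} (halpha : alpha G = 2) (h : MemW G p) : p ≤ Gᶜ.minDegree := by
  have := nonempty_of_alpha_pos (G := G) (by omega)
  obtain ⟨v, hv⟩ := Gᶜ.exists_minimal_degree_vertex
  by_contra! hlt
  have hcard : (insert v (Gᶜ.neighborFinset v)).card ≤ p := by
    have := Finset.card_insert_le v (Gᶜ.neighborFinset v)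
    rw [SimpleGraph.card_neighborFinset_eq_degree] at this
    omega
  obtain ⟨f⟩ := Function.Embedding.nonempty_of_card_le
    (α := {w // w ∈ insert v (Gᶜ.neighborFinset v)}) (β := Fin p)
    (by rwa [Fintype.card_coe, Fintype.card_fin])
  obtain ⟨M, hM, hdisj, hsub⟩ := h.2 (fun i => Finset.univ.filter fun w => ∃ hw, f ⟨w, hw⟩ = i)
    (fun i x hx y hy hxy => by
      obtain ⟨hx', hfx⟩ := (Finset.mem_filter.1 hx).2
      obtain ⟨hy', hfy⟩ := (Finset.mem_filter.1 hy).2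
      exact absurd (congrArg Subtype.val (f.injective (hfx.trans hfy.symm))) hxy)
    (fun i j hij => Finset.disjoint_left.2 fun x hx hy => by
      obtain ⟨hx', hfx⟩ := (Finset.mem_filter.1 hx).2
      obtain ⟨hy', hfy⟩ := (Finset.mem_filter.1 hy).2
      exact hij (hfx.symm.trans hfy))
  have hmem : ∀ w hw, w ∈ M (f ⟨w, hw⟩) := fun w hw =>
    hsub _ (Finset.mem_filter.2 ⟨Finset.mem_univ w, hw, rfl⟩)
  have hvS : v ∈ insert v (Gᶜ.neighborFinset v) := Finset.mem_insert_self _ _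
  obtain ⟨hind, hc⟩ := hM (f ⟨v, hvS⟩)
  obtain ⟨u, hu, huv⟩ := Finset.exists_mem_ne
    (by omega : 1 < (M (f ⟨v, hvS⟩)).card) v
  have huS : u ∈ insert v (Gᶜ.neighborFinset v) := Finset.mem_insert_of_mem <| by
    rw [SimpleGraph.mem_neighborFinset, SimpleGraph.compl_adj]
    exact ⟨huv.symm, hind (hmem v hvS) hu huv.symm⟩
  have hne : f ⟨u, huS⟩ ≠ f ⟨v, hvS⟩ := fun he =>
    huv (congrArg Subtype.val (f.injective he))
  exact Finset.disjoint_left.1 (hdisj _ _ hne) (hmem u huS) hu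

/-- When `α(G) ≤ 2` the complement is triangle-free, so an independent set of `G` contains at
most one neighbour of `x` in the complement, unless it contains `x`. -/
theorem IsIndep.card_inter_neighborFinset_compl_le_one {V : Type*} [Fintype V] [DecidableEq V]
    {G : SimpleGraph V} {S : Finset V} (halpha : alpha G ≤ 2) (hS : IsIndep G S) (x : V) :
    (S ∩ Gᶜ.neighborFinset x).card ≤ 1 := by
  refine Finset.card_le_one.2 fun a ha b hb => ?_
  simp only [Finset.mem_inter, SimpleGraph.mem_neighborFinset] at ha hb
  by_contra hab
  have habc : Gᶜ.Adj a b := (SimpleGraph.compl_adj G a b).2 ⟨hab, hS ha.1 hb.1 hab⟩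
  have h3 := (le_alpha_iff_exists_isNClique_compl G 3).2
    ⟨{x, a, b}, SimpleGraph.is3Clique_triple_iff.2 ⟨ha.2, hb.2, habc⟩⟩
  omega

theorem memW_of_le_minDegree_compl {V : Type*} [Fintype V] [DecidableEq V] {G : SimpleGraph V}
    {p : ℕ} (halpha : alpha G = 2) (h : p ≤ Gᶜ.minDegree) : MemW G p := by
  have := nonempty_of_alpha_pos (G := G) (by omega)
  refine ⟨h.trans Gᶜ.minDegree_lt_card.le,
    fun A hA hAd => ?_⟩
  obtain ⟨M, hAM, hM⟩ := (Set.toFinite {M : Fin p → Finset V | (∀ i, IsIndep G (M i)) ∧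
    ∀ i j, i ≠ j → Disjoint (M i) (M j)}).exists_le_maximal (a := A) ⟨hA, hAd⟩
  obtain ⟨hind, hdisj⟩ := hM.prop
  refine ⟨M, fun i => ⟨hind i, ?_⟩, hdisj, hAM⟩
  by_contra hne
  have hlt : (M i).card ≤ 1 := by have := (hind i).card_le_alpha; omega
  obtain ⟨x, hx⟩ : ∃ x, M i ⊆ {x} := Finset.card_le_one_iff_subset_singleton.1 hlt
  obtain ⟨y, hy, hyM⟩ : ∃ y ∈ Gᶜ.neighborFinset x,
      y ∉ (Finset.univ.erase i).biUnion fun j => M j ∩ Gᶜ.neighborFinset x := by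
    refine Finset.exists_mem_notMem_of_card_lt_card ?_
    have hle := Finset.card_biUnion_le_card_mul (Finset.univ.erase i)
      (fun j => M j ∩ Gᶜ.neighborFinset x) 1
      fun j _ => (hind j).card_inter_neighborFinset_compl_le_one halpha.le x
    have hdeg := Gᶜ.minDegree_le_degree x
    have hi := i.pos
    rw [Finset.card_erase_of_mem (Finset.mem_univ i), Finset.card_univ, Fintype.card_fin] at hle
    rw [SimpleGraph.card_neighborFinset_eq_degree]
    omega
  have hadj : Gᶜ.Adj x y := (SimpleGraph.mem_neighborFinset _ _ _).1 hy
  have hyj : ∀ j, j ≠ i → y ∉ M j := fun j hj hmem => hyM <|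
    Finset.mem_biUnion.2 ⟨j, Finset.mem_erase.2 ⟨hj, Finset.mem_univ j⟩,
      Finset.mem_inter.2 ⟨hmem, hy⟩⟩
  have hyi : y ∉ M i := fun hmem => hadj.ne (Finset.mem_singleton.1 (hx hmem)).symm
  have hpair : IsIndep G ({y, x} : Finset V) := by
    rw [isIndep_iff_isClique_compl, Finset.coe_pair, SimpleGraph.isClique_pair]
    exact fun _ => hadj.symm
  have hnew : IsIndep G (insert y (M i)) := hpair.mono (Finset.insert_subset_insert y hx)
  have hdnew : ∀ j, j ≠ i → Disjoint (insert y (M i)) (M j) := fun j hj =>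
    Finset.disjoint_insert_left.2 ⟨hyj j hj, hdisj i j hj.symm⟩
  have hle : M ≤ Function.update M i (insert y (M i)) :=
    le_update_self_iff.2 (Finset.subset_insert y (M i))
  refine hyi (hM.le_of_ge (y := Function.update M i (insert y (M i)))
    ⟨fun j => ?_, fun j k hjk => ?_⟩ hle i ?_)
  · rcases eq_or_ne j i with rfl | hj
    · simpa using hnew
    · simpa [hj] using hind j
  · rcases eq_or_ne j i with rfl | hj
    · simpa [hjk.symm] using hdnew k hjk.symm
    · rcases eq_or_ne k i with rfl | hk
      · simpa [hj] using (hdnew j hj).symm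
      · simpa [hj, hk] using hdisj j k hjk
  · simp

theorem memW_iff_le_minDegree_compl {V : Type*} [Fintype V] [DecidableEq V] {G : SimpleGraph V}
    {p : ℕ} (halpha : alpha G = 2) : MemW G p ↔ p ≤ Gᶜ.minDegree :=
  ⟨MemW.le_minDegree_compl halpha, memW_of_le_minDegree_compl halpha⟩

/-- The case `α(G) = 2`. -/
theorem alphaCritical_and_wp_iff_alpha_two {V : Type*} [Fintype V] [DecidableEq V]
    (G : SimpleGraph V) (p : ℕ) (hp : 1 ≤ p) (halpha : alpha G = 2) :
    ((AlphaCritical G ∧ MemW G p) ↔ (KSaturated Gᶜ 3 ∧ p ≤ Gᶜ.minDegree)) ∧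
      ((AlphaCritical G ∧ MemW G p) → wIndex G = Gᶜ.minDegree) := by
  refine ⟨?_, fun _ => ?_⟩
  · rw [alphaCritical_iff_kSaturated_compl, memW_iff_le_minDegree_compl halpha, halpha]
  · simp only [wIndex, memW_iff_le_minDegree_compl halpha]
    exact csSup_Iic
end

section
/- Let p ≥ 1, let G be an α-critical finite simple graph with G ∈ W_p, let r = α(G) ≥ 2, and let H be the complement of G. Then the minimum degree of H satisfies δ(H) ≥ p(r−1). -/
open Finset
open scoped Classical

/-- In a graph of `W_p`, every vertex lies in a maximum independent set. -/
theorem MemW.exists_isMaxIndep_mem {V : Type*} [Fintype V] {G : SimpleGraph V} {p : ℕ}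
    (hW : MemW G p) (hp : 1 ≤ p) (v : V) : ∃ M, IsMaxIndep G M ∧ v ∈ M := by
  obtain ⟨M, hM, -, hA⟩ := hW.2 (fun i => if i = ⟨0, hp⟩ then {v} else ∅)
    (by
      intro i x hx y hy hxy
      split_ifs at hx hy <;> simp_all)
    (by
      intro i j hij
      split_ifs <;> simp_all)
  exact ⟨M ⟨0, hp⟩, hM _, hA ⟨0, hp⟩ (by simp)⟩

/-- In a graph of `W_p`, every independent set of fewer than `α(G)` vertices has at least `p`
one-vertex independent extensions. -/
theorem MemW.le_card_extensions {V : Type*} [Fintype V] [DecidableEq V] {G : SimpleGraph V}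
    {p : ℕ} (hW : MemW G p) (hp : 1 ≤ p) {S : Finset V} (hS : IsIndep G S)
    (hcard : S.card < alpha G) :
    p ≤ (univ.filter fun x => x ∉ S ∧ IsIndep G (insert x S)).card := by
  by_contra! hlt
  set F := univ.filter fun x => x ∉ S ∧ IsIndep G (insert x S) with hF
  set o : Fin p := ⟨0, hp⟩
  obtain ⟨f⟩ : Nonempty (F ↪ {i : Fin p // i ≠ o}) := by
    apply Function.Embedding.nonempty_of_card_le
    simp only [Fintype.card_coe, ne_eq, Fintype.card_subtype_compl, Fintype.card_fin,
      Fintype.card_subtype_eq]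
    omega
  set A : Fin p → Finset V := fun i =>
    if i = o then S else univ.filter fun x => ∃ h : x ∈ F, (f ⟨x, h⟩ : Fin p) = i with hA
  have mem_A : ∀ {i x}, i ≠ o → x ∈ A i → ∃ h : x ∈ F, (f ⟨x, h⟩ : Fin p) = i := by
    intro i x hi hx
    simpa [hA, hi] using hx
  have A_o : A o = S := by simp [hA]
  have indep_A : ∀ i, IsIndep G (A i) := by
    intro i
    by_cases hi : i = o
    · rwa [hi, A_o]
    · intro x hx y hy hxy
      obtain ⟨hxF, hx⟩ := mem_A hi hx
      obtain ⟨hyF, hy⟩ := mem_A hi hy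
      exact absurd (congrArg Subtype.val (f.injective (Subtype.ext (hx.trans hy.symm)))) hxy
  have S_disj : ∀ i, i ≠ o → Disjoint S (A i) := by
    intro i hi
    rw [Finset.disjoint_left]
    intro x hxS hx
    obtain ⟨hxF, -⟩ := mem_A hi hx
    exact (mem_filter.mp hxF).2.1 hxS
  obtain ⟨M, hM, hdisj, hAM⟩ := hW.2 A indep_A (by
    intro i j hij
    by_cases hi : i = o
    · subst hi
      rw [A_o]
      exact S_disj j hij.symm
    by_cases hj : j = o
    · subst hj
      rw [A_o]
      exact (S_disj i hi).symm
    rw [Finset.disjoint_left]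
    intro x hx hy
    obtain ⟨_, hx⟩ := mem_A hi hx
    obtain ⟨_, hy⟩ := mem_A hj hy
    exact hij (hx.symm.trans hy))
  have hSM : S ⊆ M o := A_o ▸ hAM o
  obtain ⟨x, hxM, hxS⟩ := Finset.exists_mem_notMem_of_card_lt_card
    (hcard.trans_eq (hM o).2.symm)
  have hxF : x ∈ F :=
    mem_filter.mpr ⟨mem_univ _, hxS, (hM o).1.mono (insert_subset hxM hSM)⟩
  have hne := (f ⟨x, hxF⟩).2
  have hxA : x ∈ A (f ⟨x, hxF⟩) := by simp [hA, hne, hxF]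
  exact Finset.disjoint_left.mp (hdisj _ _ hne) (hAM _ hxA) hxM

/-- Complement minimum degree bound. -/
theorem complement_minDegree_bound {V : Type*} [Fintype V] [DecidableEq V]
    (G : SimpleGraph V) (p r : ℕ) (hp : 1 ≤ p)
    (hcrit : AlphaCritical G) (hW : MemW G p) (hr : 2 ≤ r) (halpha : alpha G = r) :
    p * (r - 1) ≤ Gᶜ.minDegree := by
  have : Nonempty V := Fintype.card_pos_iff.mp (hp.trans hW.1)
  apply SimpleGraph.le_minDegree_of_forall_le_degree
  intro v
  obtain ⟨M, hM, hv⟩ := hW.exists_isMaxIndep_mem hp v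
  set F : V → Finset V := fun q =>
    univ.filter fun x => x ∉ M.erase q ∧ IsIndep G (insert x (M.erase q))
  have le_card_F : ∀ q ∈ M.erase v, p ≤ (F q).card := fun q hq =>
    hW.le_card_extensions hp (hM.1.mono (erase_subset q M))
      (hM.2 ▸ card_erase_lt_of_mem (mem_of_mem_erase hq))
  have F_disj : ∀ q ∈ M.erase v, ∀ q' ∈ M.erase v, q ≠ q' → Disjoint (F q) (F q') := by
    intro q hq q' hq' hne
    rw [Finset.disjoint_left]
    intro x hx hx'
    obtain ⟨-, hxq, hx⟩ := mem_filter.mp hx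
    obtain ⟨-, hxq', hx'⟩ := mem_filter.mp hx'
    have hxM : x ∉ M := fun h => hne <| by
      simp only [mem_erase, h, and_true, not_not] at hxq hxq'
      exact hxq.symm.trans hxq'
    have hins : IsIndep G (insert x M) := by
      have key : ∀ y ∈ M, ¬ G.Adj x y := by
        intro y hy
        have hxy : x ≠ y := fun h => hxM (h ▸ hy)
        by_cases hyq : y = q
        · exact hx' (mem_insert_self _ _)
            (mem_insert_of_mem (mem_erase.mpr ⟨hyq ▸ hne, hy⟩)) hxy
        · exact hx (mem_insert_self _ _) (mem_insert_of_mem (mem_erase.mpr ⟨hyq, hy⟩)) hxy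
      intro a ha b hb hab
      rcases mem_insert.mp ha with rfl | haM <;> rcases mem_insert.mp hb with rfl | hbM
      · exact absurd rfl hab
      · exact key b hbM
      · exact fun h => key a haM h.symm
      · exact hM.1 haM hbM hab
    have hle : (insert x M).card ≤ alpha G := by
      have := Finset.le_sup (f := fun S : Finset V => if IsIndep G S then S.card else 0)
        (mem_univ (insert x M))
      simpa only [alpha, hins, if_true] using this
    rw [card_insert_of_notMem hxM, hM.2] at hle
    omega
  have hsub : (M.erase v).biUnion F ⊆ Gᶜ.neighborFinset v := by
    intro x hx
    obtain ⟨q, hq, hx⟩ := mem_biUnion.mp hx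
    obtain ⟨-, hxq, hx⟩ := mem_filter.mp hx
    have hvq : v ∈ M.erase q := mem_erase.mpr ⟨(ne_of_mem_erase hq).symm, hv⟩
    have hvx : v ≠ x := fun h => hxq (h ▸ hvq)
    rw [SimpleGraph.mem_neighborFinset, SimpleGraph.compl_adj]
    exact ⟨hvx, hx (mem_insert_of_mem hvq) (mem_insert_self _ _) hvx⟩
  calc p * (r - 1) = (M.erase v).card * p := by
        rw [card_erase_of_mem hv, hM.2, halpha, mul_comm]
    _ = ∑ _q ∈ M.erase v, p := by rw [sum_const, smul_eq_mul]
    _ ≤ ∑ q ∈ M.erase v, (F q).card := sum_le_sum le_card_F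
    _ = ((M.erase v).biUnion F).card := (card_biUnion F_disj).symm
    _ ≤ (Gᶜ.neighborFinset v).card := card_le_card hsub
    _ = Gᶜ.degree v := SimpleGraph.card_neighborFinset_eq_degree _ _
end
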